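/- arXiv:1610.05019 — 3 statements merged into one kernel-verified Lean document; each statement's English description precedes it below -/
import Mathlib

section
/- Let $d \geq 1$ and $\tau \geq 4$ be integers and let $t : \mathbb{N} \to \mathbb{N}$ be a function with $t_r = 0$ for $r < 2$ and for $r > \tau$. Set $f_0 = \sum_{r \geq 2} t_r$, $f_1 = \sum_{r \geq 2} r t_r$, and define the Hirzebruch polynomial $H(n) = n^2(f_0 + (2d^2-3d)\tau) + n(-(d^2-3d)\tau - 2f_1 + 2f_0) + 2f_1 + f_0 - d^2\tau - 4t_2$. If $H(3) \geq t_3$, then $(\tfrac{7}{2}d^2 - \tfrac{9}{2}d)\tau + t_2 + \tfrac{3}{4}t_3 \geq \sum_{r \geq 5} (r-4)t_r$. -/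
/-- Hirzebruch-type inequality for `d`-configurations obtained from the Miyaoka–Sakai
improvement at Kummer exponent `n = 3`: if `H(3) ≥ t₃` then
`(7/2 d² - 9/2 d) τ + t₂ + 3/4 t₃ ≥ ∑_{r ≥ 5} (r - 4) tᵣ`. -/
theorem stmt3 (d τ : ℕ) (hd : 1 ≤ d) (hτ : 4 ≤ τ) (t : ℕ → ℕ)
    (ht0 : ∀ r, r < 2 → t r = 0) (ht1 : ∀ r, τ < r → t r = 0)
    (f0 f1 : ℚ)
    (hf0 : f0 = ∑ r ∈ Finset.Icc 2 τ, (t r : ℚ))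
    (hf1 : f1 = ∑ r ∈ Finset.Icc 2 τ, (r : ℚ) * (t r : ℚ))
    (H : ℚ → ℚ)
    (hH : ∀ n : ℚ, H n =
      n ^ 2 * (f0 + (2 * (d : ℚ) ^ 2 - 3 * d) * τ)
      + n * (-(((d : ℚ) ^ 2 - 3 * d) * τ) - 2 * f1 + 2 * f0)
      + 2 * f1 + f0 - (d : ℚ) ^ 2 * τ - 4 * (t 2 : ℚ))
    (h3 : H 3 ≥ (t 3 : ℚ)) :
    (7 / 2 * (d : ℚ) ^ 2 - 9 / 2 * d) * τ + (t 2 : ℚ) + 3 / 4 * (t 3 : ℚ)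
      ≥ ∑ r ∈ Finset.Icc 5 τ, ((r : ℚ) - 4) * (t r : ℚ) := by
  have hsum : f1 - 4 * f0 = ∑ r ∈ Finset.Icc 2 τ, ((r : ℚ) - 4) * (t r : ℚ) := by
    rw [hf0, hf1, Finset.mul_sum, ← Finset.sum_sub_distrib]
    exact Finset.sum_congr rfl fun r _ => by ring
  have hsplit : ∑ r ∈ Finset.Icc 2 τ, ((r : ℚ) - 4) * (t r : ℚ)
      = -2 * (t 2 : ℚ) - t 3 + ∑ r ∈ Finset.Icc 5 τ, ((r : ℚ) - 4) * (t r : ℚ) := by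
    rw [← Finset.add_sum_Ioc_eq_sum_Icc (by lia : 2 ≤ τ), ← Finset.Icc_add_one_left_eq_Ioc,
      ← Finset.add_sum_Ioc_eq_sum_Icc (by lia : 2 + 1 ≤ τ), ← Finset.Icc_add_one_left_eq_Ioc,
      ← Finset.add_sum_Ioc_eq_sum_Icc (by lia : 2 + 1 + 1 ≤ τ), ← Finset.Icc_add_one_left_eq_Ioc]
    norm_num
    ring
  rw [hH] at h3
  linarith
end

section
/- Let $d \geq 2$ and $\tau \geq 4$ be integers and let $t : \mathbb{N} \to \mathbb{N}$ be a function with $t_r = 0$ for $r < 2$ and for $r > \tau$. Set $f_0 = \sum_{r \geq 2} t_r$ and $f_1 = \sum_{r \geq 2} r t_r$. Assume that $3 + (d^2-3d)\tau + f_1 - f_0 > 0$ and that $(\tfrac{7}{2}d^2 - \tfrac{9}{2}d)\tau + t_2 + t_3 \geq \sum_{r \geq 5}(r-4)t_r$. Then $\dfrac{9 + d^2\tau - 6d\tau + 3f_1 - 4f_0}{3 + (d^2-3d)\tau + f_1 - f_0} < \dfrac{8}{3}$. -/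
/-- For a `d`-configuration with `d ≥ 2`, positive `c₂`-leading-coefficient and the
Hirzebruch-type inequality `H(3) ≥ 0` imply that the characteristic number
`γ = (9 + d²τ - 6dτ + 3f₁ - 4f₀)/(3 + (d² - 3d)τ + f₁ - f₀)` is strictly below `8/3`. -/
theorem stmt5 (d τ : ℕ) (hd : 2 ≤ d) (hτ : 4 ≤ τ) (t : ℕ → ℕ)
    (ht0 : ∀ r, r < 2 → t r = 0) (ht1 : ∀ r, τ < r → t r = 0)
    (f0 f1 : ℚ)
    (hf0 : f0 = ∑ r ∈ Finset.Icc 2 τ, (t r : ℚ))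
    (hf1 : f1 = ∑ r ∈ Finset.Icc 2 τ, (r : ℚ) * (t r : ℚ))
    (hden : 0 < 3 + ((d : ℚ) ^ 2 - 3 * d) * τ + f1 - f0)
    (hH3 : (7 / 2 * (d : ℚ) ^ 2 - 9 / 2 * d) * τ + (t 2 : ℚ) + (t 3 : ℚ)
      ≥ ∑ r ∈ Finset.Icc 5 τ, ((r : ℚ) - 4) * (t r : ℚ)) :
    (9 + (d : ℚ) ^ 2 * τ - 6 * d * τ + 3 * f1 - 4 * f0)
      / (3 + ((d : ℚ) ^ 2 - 3 * d) * τ + f1 - f0) < 8 / 3 := by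
  have hsplit (g : ℕ → ℚ) : ∑ r ∈ Finset.Icc 2 τ, g r
      = g 2 + (g 3 + (g 4 + ∑ r ∈ Finset.Icc 5 τ, g r)) := by
    rw [← Finset.add_sum_Ioc_eq_sum_Icc (by omega : 2 ≤ τ), ← Finset.Icc_add_one_left_eq_Ioc,
      ← Finset.add_sum_Ioc_eq_sum_Icc (by omega : 2 + 1 ≤ τ), ← Finset.Icc_add_one_left_eq_Ioc,
      ← Finset.add_sum_Ioc_eq_sum_Icc (by omega : 2 + 1 + 1 ≤ τ),
      ← Finset.Icc_add_one_left_eq_Ioc]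
    norm_num only
  have hsum : f1 - 4 * f0 = -2 * (t 2 : ℚ) - t 3
      + ∑ r ∈ Finset.Icc 5 τ, ((r : ℚ) - 4) * (t r : ℚ) := by
    rw [hf0, hf1, hsplit, hsplit]
    simp only [sub_mul, Finset.sum_sub_distrib, ← Finset.mul_sum]
    push_cast
    ring
  have hd' : (2 : ℚ) ≤ d := by exact_mod_cast hd
  have hτ' : (4 : ℚ) ≤ τ := by exact_mod_cast hτ
  have ht2 : (0 : ℚ) ≤ t 2 := by positivity
  have hdd : (2 : ℚ) ≤ (d : ℚ) ^ 2 - d := by nlinarith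
  have hddτ : (8 : ℚ) ≤ ((d : ℚ) ^ 2 - d) * τ := by nlinarith
  rw [div_lt_div_iff₀ hden (by norm_num)]
  linarith
end

section
/- Let $\tau \geq 4$ be an integer and let $t : \mathbb{N} \to \mathbb{N}$ be a function with $t_r = 0$ for $r < 2$ and for $r > \tau$. Set $f_0 = \sum_{r \geq 2} t_r$ and $f_1 = \sum_{r \geq 2} r t_r$. Assume the combinatorial identity $\sum_{r \geq 2} \binom{r}{2} t_r = 2\tau(\tau-1)$, that $f_0 \geq \tau$, and that for every integer $n \geq 3$ one has $(3 - 2\tau + f_1 - f_0)n^2 + 2(\tau - f_1 + f_0)n + f_1 - t_2 > 0$. Then $3 - 2\tau + f_1 - f_0 > 0$. -/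
/-- For a configuration of `τ ≥ 4` conics, the combinatorial identity
`∑ C(r,2) tᵣ = 2τ(τ-1)`, the bound `f₀ ≥ τ`, and positivity of the quadratic
`c₂(Yₙ)/n^(τ-3)` for all `n ≥ 3` force the leading coefficient
`3 - 2τ + f₁ - f₀` to be strictly positive. -/
theorem stmt7 (τ : ℕ) (hτ : 4 ≤ τ) (t : ℕ → ℕ)
    (ht0 : ∀ r, r < 2 → t r = 0) (ht1 : ∀ r, τ < r → t r = 0)
    (f0 f1 : ℚ)
    (hf0 : f0 = ∑ r ∈ Finset.Icc 2 τ, (t r : ℚ))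
    (hf1 : f1 = ∑ r ∈ Finset.Icc 2 τ, (r : ℚ) * (t r : ℚ))
    (hcomb : ∑ r ∈ Finset.Icc 2 τ, Nat.choose r 2 * t r = 2 * τ * (τ - 1))
    (hf0τ : (τ : ℚ) ≤ f0)
    (hpos : ∀ n : ℕ, 3 ≤ n →
      0 < (3 - 2 * (τ : ℚ) + f1 - f0) * (n : ℚ) ^ 2
          + 2 * ((τ : ℚ) - f1 + f0) * (n : ℚ) + f1 - (t 2 : ℚ)) :
    0 < 3 - 2 * (τ : ℚ) + f1 - f0 := by
  by_contra! hA
  obtain ⟨m, hm⟩ := exists_nat_gt (f1 - (t 2 : ℚ))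
  have hn := hpos (m + 3) (by omega)
  push_cast at hn
  have hτ' : (4 : ℚ) ≤ τ := by exact_mod_cast hτ
  have hm0 : (0 : ℚ) ≤ m := m.cast_nonneg
  have hquad : (3 - 2 * (τ : ℚ) + f1 - f0) * (((m : ℚ) + 3) * (m + 1)) ≤ 0 :=
    mul_nonpos_of_nonpos_of_nonneg hA (by positivity)
  have hlin : 0 ≤ ((τ : ℚ) - 4) * (m + 3) := mul_nonneg (by linarith) (by positivity)
  linarith
end
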